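/- For every real ε with 0 < ε < 1 and every positive integer k, there exists a constant C ≥ 1 (independent of the graph) such that every connected weighted graph G on n ≥ 2 vertices has a subgraph H satisfying: (i) for all vertices x, y, d_H(x,y) ≤ (1+ε)·d_G(x,y) + (C·k/ε)^k · W(x,y); (ii) the number of edges of H is at most C·k·n^{1+3/k}; and (iii) w(H) ≤ C·(k·n^{1/k}·(log n)²/ε)·w(MST(G)). -/

import Mathlib

open scoped ENNReal

/-- The cost (total weight) of a walk in a graph, with edge weights `w`. -/
noncomputable def walkCost {V : Type*} {G : SimpleGraph V} (w : Sym2 V → ℝ) {u v : V}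
    (p : G.Walk u v) : ℝ≥0∞ :=
  (p.edges.map (fun e => ENNReal.ofReal (w e))).sum

/-- Shortest-path distance in a weighted graph (`⊤` if no walk exists). -/
noncomputable def wdist {V : Type*} (G : SimpleGraph V) (w : Sym2 V → ℝ) (u v : V) : ℝ≥0∞ :=
  ⨅ p : G.Walk u v, walkCost w p

/-- Total weight of (the edges of) a graph. -/
noncomputable def gweight {V : Type*} (w : Sym2 V → ℝ) (H : SimpleGraph V) : ℝ :=
  ∑ᶠ e ∈ H.edgeSet, w e

/-- `T` is a spanning tree of `G`. -/
def IsSpanningTree {V : Type*} (G T : SimpleGraph V) : Prop :=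
  T ≤ G ∧ T.IsTree

/-- Weight of a minimum spanning tree of `G`. -/
noncomputable def mstWeight {V : Type*} (w : Sym2 V → ℝ) (G : SimpleGraph V) : ℝ :=
  sInf {x : ℝ | ∃ T : SimpleGraph V, IsSpanningTree G T ∧ x = gweight w T}

/-- Maximum edge weight on a walk. -/
noncomputable def maxEdgeCost {V : Type*} {G : SimpleGraph V} (w : Sym2 V → ℝ) {u v : V}
    (p : G.Walk u v) : ℝ≥0∞ :=
  (p.edges.map (fun e => ENNReal.ofReal (w e))).foldr max 0

/-- `W(x,y)`: the minimum over all shortest `x`–`y` walks of the maximum edge weight on it. -/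
noncomputable def Wlocal {V : Type*} (G : SimpleGraph V) (w : Sym2 V → ℝ) (x y : V) : ℝ≥0∞ :=
  ⨅ p : {p : G.Walk x y // walkCost w p = wdist G w x y}, maxEdgeCost w p.1

namespace NearAdditive

open SimpleGraph

variable {V : Type*} {G : SimpleGraph V} {w : Sym2 V → ℝ}

/-- The real-valued cost of a walk. -/
def rcost (w : Sym2 V → ℝ) {u v : V} (p : G.Walk u v) : ℝ :=
  (p.edges.map w).sum

@[simp] lemma rcost_nil (u : V) : rcost w (Walk.nil : G.Walk u u) = 0 := by
  simp [rcost]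

@[simp] lemma rcost_cons {u v x : V} (h : G.Adj u v) (p : G.Walk v x) :
    rcost w (Walk.cons h p) = w s(u, v) + rcost w p := by
  simp [rcost]

@[simp] lemma rcost_append {u v x : V} (p : G.Walk u v) (q : G.Walk v x) :
    rcost w (p.append q) = rcost w p + rcost w q := by
  simp [rcost]

@[simp] lemma rcost_reverse {u v : V} (p : G.Walk u v) :
    rcost w p.reverse = rcost w p := by
  simp [rcost, List.sum_reverse]

lemma rcost_nonneg (hw : ∀ e ∈ G.edgeSet, 0 < w e) {u v : V} (p : G.Walk u v) :
    0 ≤ rcost w p := by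
  apply List.sum_nonneg
  intro x hx
  obtain ⟨e, he, rfl⟩ := List.mem_map.1 hx
  exact (hw e (p.edges_subset_edgeSet he)).le

lemma le_rcost_of_mem (hw : ∀ e ∈ G.edgeSet, 0 < w e) {u v : V} (p : G.Walk u v)
    {e : Sym2 V} (he : e ∈ p.edges) : w e ≤ rcost w p := by
  refine List.single_le_sum ?_ _ (List.mem_map_of_mem he)
  intro x hx
  obtain ⟨e, he, rfl⟩ := List.mem_map.1 hx
  exact (hw e (p.edges_subset_edgeSet he)).le

lemma sum_toFinset_le_rcost [DecidableEq V] (hw : ∀ e ∈ G.edgeSet, 0 < w e) {u v : V}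
    (p : G.Walk u v) : ∑ e ∈ p.edges.toFinset, w e ≤ rcost w p := by
  induction p with
  | nil => simp
  | @cons a b c h p ih =>
    have := hw _ ((mem_edgeSet G).2 h)
    simp only [Walk.edges_cons, List.toFinset_cons, rcost_cons]
    by_cases hm : s(a, b) ∈ p.edges.toFinset
    · rw [Finset.insert_eq_of_mem hm]; linarith
    · rw [Finset.sum_insert hm]; linarith

lemma walkCost_eq (hw : ∀ e ∈ G.edgeSet, 0 < w e) {u v : V} (p : G.Walk u v) :
    walkCost w p = ENNReal.ofReal (rcost w p) := by
  induction p with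
  | nil => simp [walkCost]
  | cons h p ih =>
    have := hw _ ((mem_edgeSet G).2 h)
    rw [rcost_cons, ENNReal.ofReal_add this.le (rcost_nonneg hw p), ← ih]
    simp [walkCost]

/-- The real-valued shortest-path distance. -/
noncomputable def rdist (G : SimpleGraph V) (w : Sym2 V → ℝ) (u v : V) : ℝ :=
  ⨅ p : G.Walk u v, rcost w p

lemma rdist_le (hw : ∀ e ∈ G.edgeSet, 0 < w e) {u v : V} (p : G.Walk u v) :
    rdist G w u v ≤ rcost w p :=
  ciInf_le ⟨0, by rintro _ ⟨q, rfl⟩; exact rcost_nonneg hw q⟩ p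

lemma exists_rcost_eq_rdist [Finite V] (hG : G.Connected) (hw : ∀ e ∈ G.edgeSet, 0 < w e)
    (u v : V) : ∃ p : G.Walk u v, rcost w p = rdist G w u v := by
  classical
  have := Fintype.ofFinite V
  have : Nonempty (G.Walk u v) := hG u v
  have : Nonempty (G.Path u v) := ⟨(Classical.arbitrary (G.Walk u v)).toPath⟩
  obtain ⟨q, hq⟩ := Finite.exists_min (fun q : G.Path u v => rcost w (q : G.Walk u v))
  refine ⟨q, le_antisymm (le_ciInf fun p => (hq p.toPath).trans ?_) (rdist_le hw _)⟩
  refine List.Sublist.sum_le_sum ((p.edges_bypass_sublist_edges).map w) ?_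
  intro x hx
  obtain ⟨e, he, rfl⟩ := List.mem_map.1 hx
  exact (hw e (p.edges_subset_edgeSet he)).le

section Dist

variable [Finite V]

lemma rdist_nonneg (hG : G.Connected) (hw : ∀ e ∈ G.edgeSet, 0 < w e) (u v : V) :
    0 ≤ rdist G w u v := by
  obtain ⟨p, hp⟩ := exists_rcost_eq_rdist hG hw u v
  exact hp ▸ rcost_nonneg hw p

lemma rdist_comm (hG : G.Connected) (hw : ∀ e ∈ G.edgeSet, 0 < w e) (u v : V) :
    rdist G w u v = rdist G w v u := by
  have key : ∀ u v, rdist G w u v ≤ rdist G w v u := fun u v => by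
    obtain ⟨p, hp⟩ := exists_rcost_eq_rdist hG hw v u
    simpa [hp] using rdist_le hw p.reverse
  exact le_antisymm (key u v) (key v u)

lemma rdist_triangle (hG : G.Connected) (hw : ∀ e ∈ G.edgeSet, 0 < w e)
    (u v x : V) : rdist G w u x ≤ rdist G w u v + rdist G w v x := by
  obtain ⟨p, hp⟩ := exists_rcost_eq_rdist hG hw u v
  obtain ⟨q, hq⟩ := exists_rcost_eq_rdist hG hw v x
  simpa [hp, hq] using rdist_le hw (p.append q)

/-- A next vertex on a shortest path towards `v`. -/
lemma exists_next (hG : G.Connected) (hw : ∀ e ∈ G.edgeSet, 0 < w e) (v : V) :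
    ∃ f : V → V, ∀ u, u ≠ v →
    G.Adj u (f u) ∧ rdist G w u v = w s(u, f u) + rdist G w (f u) v := by
  have : ∀ u, ∃ x, u ≠ v → G.Adj u x ∧ rdist G w u v = w s(u, x) + rdist G w x v := by
    intro u
    by_cases huv : u = v
    · exact ⟨u, fun h => (h huv).elim⟩
    obtain ⟨p, hp⟩ := exists_rcost_eq_rdist hG hw u v
    cases p with
    | nil => exact (huv rfl).elim
    | cons h q =>
      refine ⟨_, fun _ => ⟨h, le_antisymm ?_ ?_⟩⟩
      · obtain ⟨q', hq'⟩ := exists_rcost_eq_rdist hG hw _ v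
        simpa [hq'] using rdist_le hw (Walk.cons h q')
      · rw [← hp, rcost_cons]
        have := rdist_le hw q
        linarith
  choose f hf using this
  exact ⟨f, hf⟩

/-- Shortest walks whose edges are all given by a next-vertex function. -/
lemma exists_walk_next (hG : G.Connected) (hw : ∀ e ∈ G.edgeSet, 0 < w e)
    {v : V} {f : V → V} (hf : ∀ u, u ≠ v →
    G.Adj u (f u) ∧ rdist G w u v = w s(u, f u) + rdist G w (f u) v) (u : V) :
    ∃ p : G.Walk u v, rcost w p = rdist G w u v ∧ ∀ e ∈ p.edges,
      ∃ z, e = s(z, f z) ∧ rdist G w u z + rdist G w z v ≤ rdist G w u v := by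
  classical
  have := Fintype.ofFinite V
  induction hn : (Finset.univ.filter fun z => rdist G w z v < rdist G w u v).card
    using Nat.strong_induction_on generalizing u with
  | _ n ih =>
  by_cases huv : u = v
  · subst huv
    refine ⟨Walk.nil, ?_, by simp⟩
    have h1 := rdist_le hw (Walk.nil : G.Walk u u)
    have h2 := rdist_nonneg hG hw u u
    simp at h1 ⊢
    linarith
  obtain ⟨hadj, hd⟩ := hf u huv
  have hpos := hw _ ((mem_edgeSet G).2 hadj)
  have hlt : rdist G w (f u) v < rdist G w u v := by linarith
  obtain ⟨p, hp, hpe⟩ := ih _ (by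
    rw [← hn]
    apply Finset.card_lt_card
    rw [Finset.ssubset_iff_of_subset]
    · exact ⟨f u, by simpa using hlt, by simp⟩
    · intro z hz
      simp at hz ⊢
      linarith) (f u) rfl
  refine ⟨Walk.cons hadj p, by simp [hp, hd], ?_⟩
  intro e he
  rw [Walk.edges_cons, List.mem_cons] at he
  rcases he with rfl | he
  · refine ⟨u, rfl, ?_⟩
    have h1 := rdist_le hw (Walk.nil : G.Walk u u)
    simp at h1
    linarith
  · obtain ⟨z, rfl, hz⟩ := hpe e he
    refine ⟨z, rfl, ?_⟩
    have h1 := rdist_triangle hG hw u (f u) z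
    have h2 := rdist_le hw (Walk.cons hadj Walk.nil)
    simp at h2
    linarith

end Dist

/-- The elements of `A` that come, seen from `z`, no later than every element of `A'`. -/
def bunch {α : Type*} [LE α] [DecidableLE α] (key : V → V → α) (A A' : Finset V) (z : V) :
    Finset V :=
  A.filter fun v => ∀ a ∈ A', key z v ≤ key z a

lemma mem_bunch {α : Type*} [LinearOrder α] {key : V → V → α} {A A' : Finset V} {z v : V} :
    v ∈ bunch key A A' z ↔ v ∈ A ∧ ∀ a ∈ A', key z v ≤ key z a :=
  Finset.mem_filter

section Hierarchy

variable [DecidableEq V]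

/-- Greedy hitting sets. -/
lemma exists_hitting_set (A : Finset V) {B : ℕ} (hB : 0 < B) (F : Finset (Finset V))
    (hF : ∀ s ∈ F, s ⊆ A ∧ B ≤ s.card) :
    ∃ S ⊆ A, (∀ s ∈ F, ∃ a ∈ S, a ∈ s) ∧
      (S.card : ℝ) ≤ A.card * ((1 + Real.log F.card) / B) := by
  induction hn : F.card using Nat.strong_induction_on generalizing F with
  | _ n ih =>
  have hB' : (0 : ℝ) < B := by exact_mod_cast hB
  rcases F.eq_empty_or_nonempty with rfl | hne
  · refine ⟨∅, by simp, by simp, ?_⟩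
    simp at hn
    subst hn
    simp
    positivity
  have hFpos : 0 < F.card := hne.card_pos
  have hAB : B ≤ A.card := by
    obtain ⟨s, hs⟩ := hne
    exact (hF s hs).2.trans (Finset.card_le_card (hF s hs).1)
  have hApos : (0 : ℝ) < A.card := by exact_mod_cast hB.trans_le hAB
  have hFpos' : (0 : ℝ) < F.card := by exact_mod_cast hFpos
  have hlog : 0 ≤ Real.log F.card := Real.log_natCast_nonneg _
  have hsum : F.card * B ≤ ∑ a ∈ A, (F.filter fun s => a ∈ s).card := by
    calc F.card * B = ∑ s ∈ F, B := by simp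
      _ ≤ ∑ s ∈ F, s.card := Finset.sum_le_sum fun s hs => (hF s hs).2
      _ = ∑ s ∈ F, (A.filter fun a => a ∈ s).card := by
          refine Finset.sum_congr rfl fun s hs => ?_
          rw [Finset.filter_mem_eq_inter, Finset.inter_eq_right.2 (hF s hs).1]
      _ = _ := by
          simp only [Finset.card_filter]
          exact Finset.sum_comm
  obtain ⟨a, ha, hac⟩ : ∃ a ∈ A, F.card * B ≤ A.card * (F.filter fun s => a ∈ s).card := by
    by_contra! hcon
    have hAne : A.Nonempty := Finset.card_pos.1 (hB.trans_le hAB)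
    have h1 := Finset.sum_lt_sum_of_nonempty hAne hcon
    rw [← Finset.mul_sum, Finset.sum_const, smul_eq_mul] at h1
    exact absurd (Nat.lt_of_mul_lt_mul_left h1) (not_lt.2 hsum)
  have hsplit := Finset.card_filter_add_card_filter_not (s := F) (fun s => a ∈ s)
  set F' := F.filter fun s => a ∉ s with hF'
  have hcpos : 0 < (F.filter fun s => a ∈ s).card := by
    by_contra h0
    have : (F.filter fun s => a ∈ s).card = 0 := by omega
    rw [this] at hac
    have := Nat.mul_pos hFpos hB
    omega
  rcases F'.eq_empty_or_nonempty with he | hne'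
  · refine ⟨{a}, by simpa using ha, ?_, ?_⟩
    · intro s hs
      refine ⟨a, by simp, ?_⟩
      by_contra has
      have : s ∈ F' := Finset.mem_filter.2 ⟨hs, has⟩
      simp [he] at this
    · have hAB' : (B : ℝ) ≤ A.card := by exact_mod_cast hAB
      rw [← hn, Finset.card_singleton, Nat.cast_one, mul_div_assoc', le_div_iff₀ hB']
      nlinarith
  obtain ⟨S, hSA, hhit, hcard⟩ := ih F'.card (by omega) F'
    (fun s hs => hF s (Finset.mem_filter.1 hs).1) rfl
  refine ⟨insert a S, Finset.insert_subset ha hSA, ?_, ?_⟩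
  · intro s hs
    by_cases has : a ∈ s
    · exact ⟨a, by simp, has⟩
    · obtain ⟨b, hb, hbs⟩ := hhit s (Finset.mem_filter.2 ⟨hs, has⟩)
      exact ⟨b, by simp [hb], hbs⟩
  · have hF'pos : (0 : ℝ) < F'.card := by exact_mod_cast hne'.card_pos
    have h1 : (F'.card : ℝ) / F.card ≤ 1 - B / A.card := by
      rw [div_le_iff₀ hFpos', sub_mul, one_mul, div_mul_eq_mul_div, le_sub_iff_add_le,
        ← le_sub_iff_add_le', div_le_iff₀ hApos]
      have h2 : (F.card : ℝ) - F'.card = (F.filter fun s => a ∈ s).card := by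
        rw [← hsplit]; push_cast; ring
      rw [h2]
      have h3 : (F.card : ℝ) * B ≤ A.card * (F.filter fun s => a ∈ s).card := by
        exact_mod_cast hac
      linarith
    have h4 := Real.log_le_sub_one_of_pos (div_pos hF'pos hFpos')
    rw [Real.log_div hF'pos.ne' hFpos'.ne'] at h4
    have h5 : Real.log F'.card ≤ Real.log F.card - B / A.card := by linarith
    have h6 : ((insert a S).card : ℝ) ≤ S.card + 1 := by
      exact_mod_cast Finset.card_insert_le a S
    have h7 : (A.card : ℝ) * ((1 + Real.log F'.card) / B) ≤
        A.card * ((1 + (Real.log F.card - B / A.card)) / B) := by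
      gcongr
    have h8 : (A.card : ℝ) * ((1 + (Real.log F.card - B / A.card)) / B) =
        A.card * ((1 + Real.log F.card) / B) - 1 := by
      field_simp
      ring
    rw [← hn]
    linarith

variable {α : Type*} [LinearOrder α]

lemma exists_next_level [Fintype V] (key : V → V → α)
    (hkey : ∀ z, Function.Injective (key z)) (A : Finset V) {B : ℕ} (hB : 0 < B) :
    ∃ A' ⊆ A, (∀ z, (bunch key A A' z).card ≤ B) ∧
      (A'.card : ℝ) ≤ A.card * ((1 + 2 * Real.log (Fintype.card V)) / B) := by
  set F : Finset (Finset V) := ((Finset.univ : Finset (V × V)).image fun x =>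
    A.filter fun v => key x.1 v < key x.1 x.2).filter fun s => B ≤ s.card with hFdef
  have hFc : F.card ≤ Fintype.card V ^ 2 := by
    refine (Finset.card_filter_le _ _).trans (Finset.card_image_le.trans ?_)
    simp [sq]
  obtain ⟨S, hSA, hhit, hcard⟩ := exists_hitting_set A hB F (by
    intro s hs
    rw [hFdef, Finset.mem_filter, Finset.mem_image] at hs
    obtain ⟨⟨x, -, rfl⟩, hc⟩ := hs
    exact ⟨Finset.filter_subset _ _, hc⟩)
  refine ⟨S, hSA, fun z => ?_, hcard.trans ?_⟩
  · by_contra! hlt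
    have hne : (bunch key A S z).Nonempty := Finset.card_pos.1 (by omega)
    obtain ⟨m, hm, hmax⟩ := Finset.exists_max_image _ (key z) hne
    have hmem : (A.filter fun v => key z v < key z m) ∈ F := by
      rw [hFdef, Finset.mem_filter, Finset.mem_image]
      refine ⟨⟨(z, m), by simp, rfl⟩, ?_⟩
      have h1 : (bunch key A S z).erase m ⊆ A.filter fun v => key z v < key z m := by
        intro v hv
        rw [Finset.mem_erase] at hv
        refine Finset.mem_filter.2 ⟨(mem_bunch.1 hv.2).1, lt_of_le_of_ne (hmax v hv.2) ?_⟩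
        exact fun h => hv.1 (hkey z h)
      have h2 := Finset.card_le_card h1
      rw [Finset.card_erase_of_mem hm] at h2
      exact (Nat.le_sub_one_of_lt hlt).trans h2
    obtain ⟨a, haS, ha⟩ := hhit _ hmem
    exact absurd (Finset.mem_filter.1 ha).2 (not_lt.2 ((mem_bunch.1 hm).2 a haS))
  · gcongr
    rcases F.eq_empty_or_nonempty with he | hne
    · simp [he, Real.log_natCast_nonneg]
    · have h1 : Real.log F.card ≤ Real.log ((Fintype.card V : ℝ) ^ 2) :=
        Real.log_le_log (by exact_mod_cast hne.card_pos) (by exact_mod_cast hFc)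
      simpa [Real.log_pow] using h1

/-- A sequence of levels with small bunches and geometrically decreasing sizes. -/
lemma exists_levels [Fintype V] (key : V → V → α) (hkey : ∀ z, Function.Injective (key z))
    (N : Finset V) {B : ℕ} (hB : 0 < B) :
    ∃ A : ℕ → Finset V, A 0 = N ∧ (∀ i, A i ⊆ N) ∧ (∀ i, A (i + 1) ⊆ A i) ∧
      (∀ i z, (bunch key (A i) (A (i + 1)) z).card ≤ B) ∧
      ∀ i, ((A i).card : ℝ) ≤ N.card * ((1 + 2 * Real.log (Fintype.card V)) / B) ^ i := by
  choose f hfsub hfbunch hfcard using fun A => exists_next_level key hkey A hB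
  have hsucc : ∀ i, f^[i + 1] N = f (f^[i] N) := fun i => Function.iterate_succ_apply' f i N
  refine ⟨fun i => f^[i] N, rfl, fun i => ?_, fun i => ?_, fun i z => ?_, fun i => ?_⟩
  · induction i with
    | zero => simp
    | succ i ih => simp only [hsucc]; exact (hfsub _).trans ih
  · simp only [hsucc]; exact hfsub _
  · simp only [hsucc]; exact hfbunch _ z
  · induction i with
    | zero => simp
    | succ i ih =>
      have h0 : 0 ≤ (1 + 2 * Real.log (Fintype.card V)) / B := by
        have := Real.log_natCast_nonneg (Fintype.card V)
        positivity
      simp only [hsucc]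
      refine (hfcard _).trans ((mul_le_mul_of_nonneg_right ih h0).trans_eq ?_)
      ring

end Hierarchy

lemma sum_biUnion_le [DecidableEq V] {ι : Type*} [DecidableEq ι] (hw : ∀ e ∈ G.edgeSet, 0 < w e)
    (s : Finset ι) (t : ι → Finset (Sym2 V)) (ht : ∀ v ∈ s, ∀ e ∈ t v, e ∈ G.edgeSet) :
    ∑ e ∈ s.biUnion t, w e ≤ ∑ v ∈ s, ∑ e ∈ t v, w e := by
  induction s using Finset.induction_on with
  | empty => simp
  | insert a s ha ih =>
    rw [Finset.biUnion_insert, Finset.sum_insert ha]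
    have h1 := Finset.sum_union_inter (s₁ := t a) (s₂ := s.biUnion t) (f := w)
    have h2 : 0 ≤ ∑ e ∈ t a ∩ s.biUnion t, w e := Finset.sum_nonneg fun e he =>
      (hw e (ht a (by simp) e (Finset.mem_inter.1 he).1)).le
    have h3 := ih fun v hv => ht v (by simp [hv])
    linarith

section LevelEdges

variable [Fintype V]

/-- Vertices ordered by their distance from `z`, ties broken by a fixed enumeration. -/
noncomputable def distKey (G : SimpleGraph V) (w : Sym2 V → ℝ) (z v : V) :
    ℝ ×ₗ Fin (Fintype.card V) :=
  toLex (rdist G w z v, Fintype.equivFin V v)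

lemma distKey_injective (z : V) : Function.Injective (distKey G w z) := by
  intro u v h
  have h1 := congrArg (fun x => (ofLex x).2) h
  simpa [distKey] using h1

lemma distKey_le {z u v : V} : distKey G w z u ≤ distKey G w z v ↔
    rdist G w z u < rdist G w z v ∨
      rdist G w z u = rdist G w z v ∧ Fintype.equivFin V u ≤ Fintype.equivFin V v :=
  Prod.Lex.toLex_le_toLex

lemma rdist_le_of_distKey_le {z u v : V} (h : distKey G w z u ≤ distKey G w z v) :
    rdist G w z u ≤ rdist G w z v := by
  rcases distKey_le.1 h with h | h
  · exact h.le
  · exact h.1.le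

lemma distKey_le_of_between (hG : G.Connected) (hw : ∀ e ∈ G.edgeSet, 0 < w e) {u v z a : V}
    (hz : rdist G w u z + rdist G w z v ≤ rdist G w u v)
    (h : distKey G w u v ≤ distKey G w u a) : distKey G w z v ≤ distKey G w z a := by
  have h1 := rdist_triangle hG hw u z a
  rw [distKey_le] at h ⊢
  rcases h with h | ⟨h, h'⟩
  · left; linarith
  · rcases lt_or_ge (rdist G w z v) (rdist G w z a) with h2 | h2
    · exact Or.inl h2
    · exact Or.inr ⟨by linarith, h'⟩

/-- Few and light edges that realize the distances to the elements of the bunches. -/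
lemma exists_level_edges [DecidableEq V] (hG : G.Connected) (hw : ∀ e ∈ G.edgeSet, 0 < w e)
    (A A' : Finset V) {B : ℕ} {r : ℝ} (hr : 0 ≤ r)
    (hB : ∀ z, (bunch (distKey G w) A A' z).card ≤ B) :
    ∃ E : Finset (Sym2 V), (∀ e ∈ E, e ∈ G.edgeSet) ∧ E.card ≤ Fintype.card V * B ∧
      ∑ e ∈ E, w e ≤ A.card * (B * r) ∧
      ∀ u ∈ A, ∀ v ∈ bunch (distKey G w) A A' u, rdist G w u v ≤ r →
        ∃ p : G.Walk u v, rcost w p = rdist G w u v ∧ ∀ e ∈ p.edges, e ∈ E := by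
  choose f hf using exists_next hG hw
  choose P hP hPe using fun u v => exists_walk_next hG hw (hf v) u
  set S : V → Finset V := fun u =>
    (bunch (distKey G w) A A' u).filter fun v => rdist G w u v ≤ r
  set E : Finset (Sym2 V) := A.biUnion fun u => (S u).biUnion fun v => (P u v).edges.toFinset
  have hE : ∀ e ∈ E, e ∈ G.edgeSet := by
    intro e he
    simp only [E, Finset.mem_biUnion, List.mem_toFinset] at he
    obtain ⟨u, -, v, -, he⟩ := he
    exact (P u v).edges_subset_edgeSet he
  refine ⟨E, hE, ?_, ?_, ?_⟩
  · have hsub : E ⊆ (Finset.univ : Finset V).biUnion fun z =>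
        (bunch (distKey G w) A A' z).image fun v => s(z, f v z) := by
      intro e he
      simp only [E, Finset.mem_biUnion, List.mem_toFinset] at he
      obtain ⟨u, -, v, hv, he⟩ := he
      obtain ⟨z, rfl, hz⟩ := hPe u v e he
      have hv' := mem_bunch.1 (Finset.mem_filter.1 hv).1
      refine Finset.mem_biUnion.2 ⟨z, Finset.mem_univ z, Finset.mem_image.2 ⟨v, ?_, rfl⟩⟩
      exact mem_bunch.2 ⟨hv'.1, fun a ha => distKey_le_of_between hG hw hz (hv'.2 a ha)⟩
    refine (Finset.card_le_card hsub).trans (Finset.card_biUnion_le_card_mul _ _ _ ?_)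
    exact fun z _ => Finset.card_image_le.trans (hB z)
  · refine (sum_biUnion_le hw _ _ ?_).trans ?_
    · intro u hu e he
      exact hE e (Finset.mem_biUnion.2 ⟨u, hu, he⟩)
    rw [← nsmul_eq_mul]
    refine Finset.sum_le_card_nsmul _ _ _ fun u hu => ?_
    refine (sum_biUnion_le hw _ _ ?_).trans ?_
    · intro v _ e he
      exact (P u v).edges_subset_edgeSet (List.mem_toFinset.1 he)
    calc ∑ v ∈ S u, ∑ e ∈ (P u v).edges.toFinset, w e ≤ (S u).card • r := by
          refine Finset.sum_le_card_nsmul _ _ _ fun v hv => ?_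
          exact (sum_toFinset_le_rcost hw _).trans ((hP u v).trans_le (Finset.mem_filter.1 hv).2)
      _ ≤ B * r := by
          rw [nsmul_eq_mul]
          have : (S u).card ≤ B := (Finset.card_filter_le _ _).trans (hB u)
          gcongr
  · intro u hu v hv hd
    refine ⟨P u v, hP u v, fun e he => ?_⟩
    simp only [E, Finset.mem_biUnion, List.mem_toFinset]
    exact ⟨u, hu, v, Finset.mem_filter.2 ⟨hv, hd⟩, he⟩

end LevelEdges

section Stretch

/-- There is a walk of cost at most `c` in `H`. -/
def Conn (H : SimpleGraph V) (w : Sym2 V → ℝ) (x y : V) (c : ℝ) : Prop :=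
  ∃ p : H.Walk x y, rcost w p ≤ c

variable {H : SimpleGraph V} {x y z : V} {c c' : ℝ}

lemma Conn.refl (hc : 0 ≤ c) : Conn H w x x c := ⟨Walk.nil, by simpa using hc⟩

lemma Conn.symm (h : Conn H w x y c) : Conn H w y x c := by
  obtain ⟨p, hp⟩ := h
  exact ⟨p.reverse, by simpa using hp⟩

lemma Conn.trans (h : Conn H w x y c) (h' : Conn H w y z c') : Conn H w x z (c + c') := by
  obtain ⟨p, hp⟩ := h
  obtain ⟨q, hq⟩ := h'
  exact ⟨p.append q, by rw [rcost_append]; linarith⟩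

lemma Conn.mono (h : Conn H w x y c) (hc : c ≤ c') : Conn H w x y c' := by
  obtain ⟨p, hp⟩ := h
  exact ⟨p, hp.trans hc⟩

lemma conn_of_edges {p : G.Walk x y} (hp : ∀ e ∈ p.edges, e ∈ H.edgeSet)
    (hc : rcost w p ≤ c) : Conn H w x y c :=
  ⟨p.transfer H hp, by simpa [rcost] using hc⟩

lemma Conn.of_le (h : Conn H w x y c) (hHG : H ≤ G) : Conn G w x y c := by
  obtain ⟨p, hp⟩ := h
  exact conn_of_edges (fun e he => edgeSet_mono hHG (p.edges_subset_edgeSet he)) hp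

lemma Conn.rdist_le (hw : ∀ e ∈ G.edgeSet, 0 < w e) (h : Conn G w x y c) :
    rdist G w x y ≤ c := by
  obtain ⟨p, hp⟩ := h
  exact (NearAdditive.rdist_le hw p).trans hp

lemma exists_split {W : ℝ} (p : G.Walk x y) (hp : ∀ e ∈ p.edges, w e ≤ W) {t : ℝ} (ht : 0 < t)
    (htp : t ≤ rcost w p) :
    ∃ (m : V) (p₁ : G.Walk x m) (p₂ : G.Walk m y), (∀ e ∈ p₁.edges, w e ≤ W) ∧
      (∀ e ∈ p₂.edges, w e ≤ W) ∧ rcost w p₁ + rcost w p₂ = rcost w p ∧ t ≤ rcost w p₁ ∧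
      rcost w p₁ ≤ t + W ∧ p₂.length < p.length := by
  induction p generalizing t with
  | nil => simp at htp; linarith
  | @cons a b d h q ih =>
    have hab : w s(a, b) ≤ W := hp _ (by simp)
    have hq : ∀ e ∈ q.edges, w e ≤ W := fun e he => hp e (by simp [he])
    rcases le_or_gt t (w s(a, b)) with hle | hlt
    · refine ⟨b, Walk.cons h Walk.nil, q, by simpa using hab, hq, by simp, by simpa using hle,
        ?_, by simp⟩
      simp
      linarith
    · rw [rcost_cons] at htp
      obtain ⟨m, p₁, p₂, h1, h2, h3, h4, h5, h6⟩ := ih hq (sub_pos.2 hlt) (by linarith)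
      refine ⟨m, Walk.cons h p₁, p₂, ?_, h2, ?_, ?_, ?_, ?_⟩
      · intro e he
        rw [Walk.edges_cons, List.mem_cons] at he
        rcases he with rfl | he
        · exact hab
        · exact h1 e he
      · simp only [rcost_cons]; linarith
      · simp only [rcost_cons]; linarith
      · simp only [rcost_cons]; linarith
      · simp only [Walk.length_cons]; omega

/-- Either `x` and `y` are well connected in `H`, or they are so up to a middle part between two
vertices satisfying `g`. -/
def Covered (G H : SimpleGraph V) (w : Sym2 V → ℝ) (g : V → Prop) (α c : ℝ) (x y : V)
    (L : ℝ) : Prop :=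
  Conn H w x y (α * L + c) ∨ ∃ u v c₁ c₂ c₃, g u ∧ g v ∧ 0 ≤ c₁ ∧ 0 ≤ c₂ ∧ 0 ≤ c₃ ∧
    Conn G w x u c₁ ∧ Conn H w x u (α * c₁ + c) ∧ Conn G w u v c₂ ∧
    Conn H w v y (α * c₃ + c) ∧ c₁ + c₂ + c₃ ≤ L

lemma covered_of_segments (hw : ∀ e ∈ G.edgeSet, 0 < w e) {g : V → Prop} {α δ l W : ℝ}
    (hstep : ∀ (x y : V) (p : G.Walk x y), (∀ e ∈ p.edges, w e ≤ W) → rcost w p ≤ l →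
      Conn H w x y (α * rcost w p + c) ∨ (g x ∧ g y))
    (hl : 0 < l) (hWl : 2 * W ≤ l) (hc : 0 ≤ c) (hδ : 0 ≤ δ) (hcl : 2 * c ≤ δ * l)
    (p : G.Walk x y) (hp : ∀ e ∈ p.edges, w e ≤ W) :
    Covered G H w g (α + δ) c x y (rcost w p) := by
  induction hn : p.length using Nat.strong_induction_on generalizing x p with
  | _ n ih =>
  have hp0 := rcost_nonneg hw p
  rcases le_or_gt (rcost w p) l with hle | hlt
  · rcases hstep x y p hp hle with h | ⟨hx, hy⟩
    · exact Or.inl (h.mono (by nlinarith))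
    · exact Or.inr ⟨x, y, 0, rcost w p, 0, hx, hy, le_rfl, hp0, le_rfl, Conn.refl le_rfl,
        Conn.refl (by linarith), ⟨p, le_rfl⟩, Conn.refl (by linarith), by linarith⟩
  obtain ⟨m, p₁, p₂, h1, h2, h3, h4, h5, h6⟩ := exists_split p hp (half_pos hl) (by linarith)
  have hp1 := rcost_nonneg hw p₁
  have hp2 := rcost_nonneg hw p₂
  have htail := ih p₂.length (hn ▸ h6) p₂ h2 rfl
  rcases hstep x m p₁ h1 (by linarith) with hgood | ⟨hx, hm⟩
  · have hgood' : Conn H w x m ((α + δ) * rcost w p₁) := hgood.mono (by nlinarith)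
    rcases htail with h | ⟨u, v, c₁, c₂, c₃, hu, hv, hc₁, hc₂, hc₃, g1, g2, g3, g4, g5⟩
    · refine Or.inl ((hgood'.trans h).mono (le_of_eq ?_))
      rw [← h3]; ring
    · refine Or.inr ⟨u, v, rcost w p₁ + c₁, c₂, c₃, hu, hv, by linarith, hc₂, hc₃,
        Conn.trans ⟨p₁, le_rfl⟩ g1, (hgood'.trans g2).mono (le_of_eq (by ring)), g3, g4,
        by linarith⟩
  · rcases htail with h | ⟨u, v, c₁, c₂, c₃, hu, hv, hc₁, hc₂, hc₃, g1, g2, g3, g4, g5⟩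
    · exact Or.inr ⟨x, m, 0, rcost w p₁, rcost w p₂, hx, hm, le_rfl, hp1, hp2,
        Conn.refl le_rfl, Conn.refl (by linarith), ⟨p₁, le_rfl⟩, h, by linarith⟩
    · exact Or.inr ⟨x, v, 0, rcost w p₁ + c₁ + c₂, c₃, hx, hv, le_rfl, by linarith, hc₃,
        Conn.refl le_rfl, Conn.refl (by linarith), (Conn.trans ⟨p₁, le_rfl⟩ g1).trans g3, g4,
        by linarith⟩

/-- The near-additive stretch guaranteed by a sequence of levels that ends with the empty set. -/
lemma conn_of_levels (hHG : H ≤ G) (hw : ∀ e ∈ G.edgeSet, 0 < w e) (A : ℕ → Finset V) (K : ℕ)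
    (hA : A K = ∅) {r W δ : ℝ} (hδ : 0 < δ) (hδ1 : δ ≤ 1) (hKδ : K * δ ≤ 1) (hW : 0 < W)
    (hr : (33 / δ) ^ K * W ≤ r)
    (hnext : ∀ i < K, ∀ u ∈ A i, ∀ v ∈ A i, rdist G w u v ≤ r →
      Conn H w u v (rdist G w u v) ∨ ∃ a ∈ A (i + 1), Conn H w u a (rdist G w u v))
    (hcover : ∀ x, ∃ a ∈ A 0, Conn H w x a W)
    (p : G.Walk x y) (hp : ∀ e ∈ p.edges, w e ≤ W) :
    Conn H w x y ((1 + K * δ) * rcost w p + (33 / δ) ^ K * W) := by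
  have hD : 1 ≤ 33 / δ := by rw [le_div_iff₀ hδ]; linarith
  have main : ∀ i ≤ K, ∀ (x y : V) (p : G.Walk x y), (∀ e ∈ p.edges, w e ≤ W) →
      Covered G H w (fun x => ∃ a ∈ A i, Conn H w x a ((33 / δ) ^ i * W)) (1 + i * δ)
        ((33 / δ) ^ i * W) x y (rcost w p) := by
    intro i
    induction i with
    | zero =>
      intro _ x y p _
      have hp0 := rcost_nonneg hw p
      refine Or.inr ⟨x, y, 0, rcost w p, 0, ?_, ?_, le_rfl, hp0, le_rfl, Conn.refl le_rfl,
        Conn.refl ?_, ⟨p, le_rfl⟩, Conn.refl ?_, by linarith⟩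
      · simpa using hcover x
      · simpa using hcover y
      · simpa using hW.le
      · simpa using hW.le
    | succ i ih =>
      intro hi x y p hp
      have ih := ih (by omega)
      set a : ℝ := (33 / δ) ^ i * W with ha
      have haW : W ≤ a := le_mul_of_one_le_left hW.le (one_le_pow₀ hD)
      set q : ℝ := a / δ with hq
      have hqa : q * δ = a := div_mul_cancel₀ _ hδ.ne'
      have haq : a ≤ q := by rw [hq, le_div_iff₀ hδ]; nlinarith
      have hnxt : (33 / δ) ^ (i + 1) * W = 33 * q := by
        rw [hq, ha, pow_succ]; ring
      have hqr : 33 * q ≤ r := by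
        rw [← hnxt]
        refine le_trans ?_ hr
        gcongr
      have hiδ : (i : ℝ) * δ ≤ 1 := by
        refine le_trans ?_ hKδ
        gcongr
        omega
      have hiδ0 : 0 ≤ (i : ℝ) * δ := by positivity
      rw [hnxt]
      have key := covered_of_segments (H := H) (c := 6 * a) (α := 1 + i * δ) (δ := δ)
        (l := 12 * q) (W := W) (g := fun x => ∃ b ∈ A (i + 1), Conn H w x b (33 * q)) hw ?_
        (by linarith) (by linarith) (by linarith) hδ.le (by nlinarith) p hp
      · have hα : (1 : ℝ) + i * δ + δ = 1 + ((i + 1 : ℕ) : ℝ) * δ := by push_cast; ring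
        rw [hα] at key
        rcases key with h | ⟨u, v, c₁, c₂, c₃, hu, hv, hc₁, hc₂, hc₃, g1, g2, g3, g4, g5⟩
        · exact Or.inl (h.mono (by linarith))
        · exact Or.inr ⟨u, v, c₁, c₂, c₃, hu, hv, hc₁, hc₂, hc₃, g1, g2.mono (by linarith), g3,
            g4.mono (by linarith), g5⟩
      · intro x y p hp hpl
        rcases ih x y p hp with h | ⟨u, v, c₁, c₂, c₃, ⟨s, hs, hus⟩, ⟨t, ht, hvt⟩, hc₁, hc₂, hc₃,
          g1, g2, g3, g4, g5⟩
        · exact Or.inl (h.mono (by linarith))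
        have hst : rdist G w s t ≤ c₂ + 2 * a :=
          (((hus.of_le hHG).symm.trans (g3.trans (hvt.of_le hHG))).mono (by linarith)).rdist_le hw
        have hts : rdist G w t s ≤ c₂ + 2 * a :=
          (((hvt.of_le hHG).symm.trans (g3.symm.trans (hus.of_le hHG))).mono
            (by linarith)).rdist_le hw
        have e1 : (i : ℝ) * δ * c₁ ≤ c₁ := by nlinarith
        have e3 : (i : ℝ) * δ * c₃ ≤ c₃ := by nlinarith
        have e4 : (i : ℝ) * δ * (c₁ + c₃) ≤ i * δ * rcost w p :=
          mul_le_mul_of_nonneg_left (by linarith) hiδ0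
        rcases hnext i (by omega) s hs t ht (by linarith) with h | ⟨b, hb, hsb⟩
        · exact Or.inl ((g2.trans (hus.trans (h.trans (hvt.symm.trans g4)))).mono
            (by nlinarith))
        rcases hnext i (by omega) t ht s hs (by linarith) with h | ⟨b', hb', htb⟩
        · exact Or.inl ((g2.trans (hus.trans (h.symm.trans (hvt.symm.trans g4)))).mono
            (by nlinarith))
        · exact Or.inr ⟨⟨b, hb, (g2.trans (hus.trans hsb)).mono (by nlinarith)⟩,
            ⟨b', hb', (g4.symm.trans (hvt.trans htb)).mono (by nlinarith)⟩⟩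
  rcases main K le_rfl x y p hp with h | ⟨u, v, c₁, c₂, c₃, ⟨s, hs, -⟩, -⟩
  · exact h
  · simp [hA] at hs

end Stretch

lemma gweight_eq_sum {S : Finset (Sym2 V)} (hS : G.edgeSet = S) :
    gweight w G = ∑ e ∈ S, w e := by
  rw [gweight, hS, finsum_mem_coe_finset]

lemma exists_net_of_walk {T : SimpleGraph V} {W : ℝ} {u v : V} (p : T.Walk u v) (a : V)
    {s : ℝ} (hs : 0 ≤ s) (hsW : s ≤ W) (ha : Conn T w u a s) (hw : ∀ e ∈ T.edgeSet, 0 < w e) :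
    ∃ N : Finset V, N.card * W ≤ rcost w p + s ∧
      ∀ x ∈ p.support, ∃ b, (b = a ∨ b ∈ N) ∧ Conn T w x b W := by
  classical
  induction p generalizing a s with
  | nil => exact ⟨∅, by simpa using hs, fun x hx => ⟨a, by simp, by
      simp at hx; subst hx; exact ha.mono hsW⟩⟩
  | @cons u m v h q ih =>
    have hpos := hw _ ((mem_edgeSet T).2 h)
    have hstep : Conn T w m u (w s(u, m)) :=
      Conn.symm ⟨Walk.cons h Walk.nil, by simp⟩
    rcases le_or_gt (s + w s(u, m)) W with hle | hlt
    · obtain ⟨N, hN, hcov⟩ := ih a (add_nonneg hs hpos.le) hle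
        ((hstep.trans ha).mono (by linarith))
      refine ⟨N, by rw [rcost_cons]; linarith, fun x hx => ?_⟩
      rw [Walk.support_cons, List.mem_cons] at hx
      rcases hx with rfl | hx
      · exact ⟨a, Or.inl rfl, ha.mono hsW⟩
      · exact hcov x hx
    · obtain ⟨N, hN, hcov⟩ := ih m le_rfl (hs.trans hsW) (Conn.refl le_rfl)
      refine ⟨insert m N, ?_, fun x hx => ?_⟩
      · have h1 : ((insert m N).card : ℝ) ≤ N.card + 1 := by
          exact_mod_cast Finset.card_insert_le m N
        rw [rcost_cons]
        nlinarith
      · rw [Walk.support_cons, List.mem_cons] at hx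
        rcases hx with rfl | hx
        · exact ⟨a, Or.inl rfl, ha.mono hsW⟩
        · obtain ⟨b, hb, hxb⟩ := hcov x hx
          exact ⟨b, Or.inr (by simpa using hb), hxb⟩

section Net

variable [Fintype V] {T : SimpleGraph V}

/-- A connected graph has a closed walk that visits all vertices and costs at most twice the total
weight. -/
lemma exists_tour (hT : T.Connected) (hw : ∀ e ∈ T.edgeSet, 0 < w e) (v : V) :
    ∃ p : T.Walk v v, (∀ x, x ∈ p.support) ∧ rcost w p ≤ 2 * gweight w T := by
  classical
  have main : ∀ m ≤ Fintype.card V, ∃ p : T.Walk v v, m ≤ p.support.toFinset.card ∧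
      rcost w p ≤ 2 * ∑ e ∈ p.edges.toFinset, w e := by
    intro m
    induction m with
    | zero => exact fun _ => ⟨Walk.nil, by simp, by simp⟩
    | succ m ih =>
      intro hm
      obtain ⟨p, hp, hpw⟩ := ih (by omega)
      rcases Nat.lt_or_ge m p.support.toFinset.card with hlt | hge
      · exact ⟨p, hlt, hpw⟩
      obtain ⟨x, hx⟩ : ∃ x, x ∉ p.support.toFinset := by
        by_contra! hcon
        have := Finset.eq_univ_iff_forall.2 hcon
        rw [this, Finset.card_univ] at hge
        omega
      obtain ⟨q⟩ := hT v x
      obtain ⟨d, -, hd1, hd2⟩ := q.exists_boundary_dart {y | y ∈ p.support}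
        p.start_mem_support (by simpa using hx)
      obtain ⟨⟨a, b⟩, hab⟩ := d
      simp only [Set.mem_ofPred_eq] at hd1 hd2
      set p' : T.Walk v v :=
        (p.takeUntil a hd1).append (Walk.cons hab (Walk.cons hab.symm (p.dropUntil a hd1)))
      have hcost : rcost w p' = rcost w p + 2 * w s(a, b) := by
        conv_rhs => rw [← p.take_spec hd1]
        simp only [p', rcost_append, rcost_cons, Sym2.eq_swap (a := b)]
        ring
      have hedges : p'.edges.toFinset = insert s(a, b) p.edges.toFinset := by
        have hp_edges : p.edges = (p.takeUntil a hd1).edges ++ (p.dropUntil a hd1).edges := by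
          rw [← Walk.edges_append, Walk.take_spec]
        ext e
        simp only [p', hp_edges, Walk.edges_append, Walk.edges_cons, Sym2.eq_swap (a := b),
          List.mem_toFinset, List.mem_append, List.mem_cons, Finset.mem_insert]
        tauto
      have hsupp : insert b p.support.toFinset ⊆ p'.support.toFinset := by
        intro y hy
        rw [← p.take_spec hd1] at hy
        simp only [Finset.mem_insert, List.mem_toFinset, Walk.mem_support_append_iff] at hy
        simp only [p', List.mem_toFinset, Walk.mem_support_append_iff, Walk.support_cons,
          List.mem_cons]
        tauto
      have hnot : s(a, b) ∉ p.edges.toFinset := fun h =>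
        hd2 (p.snd_mem_support_of_mem_edges (List.mem_toFinset.1 h))
      refine ⟨p', ?_, ?_⟩
      · have h1 := Finset.card_le_card hsupp
        rw [Finset.card_insert_of_notMem (by simpa using hd2)] at h1
        omega
      · rw [hcost, hedges, Finset.sum_insert hnot]
        linarith
  obtain ⟨p, hp, hpw⟩ := main _ le_rfl
  refine ⟨p, fun x => ?_, hpw.trans ?_⟩
  · have h1 := Finset.eq_univ_of_card _ (le_antisymm (Finset.card_le_univ _) hp)
    exact List.mem_toFinset.1 (h1 ▸ Finset.mem_univ x)
  · rw [gweight_eq_sum (S := T.edgeSet.toFinset) (by simp)]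
    gcongr ?_ * ?_
    refine Finset.sum_le_sum_of_subset_of_nonneg ?_ ?_
    · intro e he
      simpa using p.edges_subset_edgeSet (List.mem_toFinset.1 he)
    · intro e he _
      exact (hw e (by simpa using he)).le

/-- A connected graph has small nets at every scale. -/
lemma exists_net (hT : T.Connected) (hw : ∀ e ∈ T.edgeSet, 0 < w e) {W : ℝ} (hW : 0 < W) :
    ∃ N : Finset V, N.card * W ≤ 2 * gweight w T + W ∧ ∀ x, ∃ b ∈ N, Conn T w x b W := by
  classical
  obtain ⟨v⟩ := hT.nonempty
  obtain ⟨p, hp, hpw⟩ := exists_tour hT hw v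
  obtain ⟨N, hN, hcov⟩ := exists_net_of_walk p v le_rfl hW.le (Conn.refl le_rfl) hw
  refine ⟨insert v N, ?_, fun x => ?_⟩
  · have h1 : ((insert v N).card : ℝ) ≤ N.card + 1 := by
      exact_mod_cast Finset.card_insert_le v N
    nlinarith
  · obtain ⟨b, hb, hxb⟩ := hcov x (hp x)
    exact ⟨b, by simpa using hb, hxb⟩

end Net

/-- The edges that take care of all walks with edges of at most a given weight. -/
lemma exists_scale_edges [Fintype V] [DecidableEq V] (hG : G.Connected)
    (hw : ∀ e ∈ G.edgeSet, 0 < w e) (N : Finset V) (K : ℕ) {B : ℕ} (hB : 0 < B)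
    (hK : (Fintype.card V : ℝ) * ((1 + 2 * Real.log (Fintype.card V)) / B) ^ K < 1)
    {δ W₀ : ℝ} (hδ : 0 < δ) (hδ1 : δ ≤ 1) (hKδ : K * δ ≤ 1) (hW₀ : 0 < W₀) :
    ∃ E : Finset (Sym2 V), (∀ e ∈ E, e ∈ G.edgeSet) ∧ E.card ≤ K * (Fintype.card V * B) ∧
      ∑ e ∈ E, w e ≤ K * (N.card * (B * ((33 / δ) ^ K * W₀))) ∧
      ∀ H ≤ G, (∀ e ∈ E, e ∈ H.edgeSet) → ∀ W, 0 < W → W ≤ W₀ →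
        (∀ x, ∃ a ∈ N, Conn H w x a W) → ∀ (x y : V) (p : G.Walk x y),
        (∀ e ∈ p.edges, w e ≤ W) →
        Conn H w x y ((1 + K * δ) * rcost w p + (33 / δ) ^ K * W) := by
  obtain ⟨A, hA0, hAN, hAA, hAB, hAc⟩ := exists_levels (distKey G w) distKey_injective N hB
  have hAK : A K = ∅ := by
    have h1 : ((A K).card : ℝ) < 1 := by
      refine lt_of_le_of_lt ((hAc K).trans ?_) hK
      have h0 : 0 ≤ (1 + 2 * Real.log (Fintype.card V)) / B := by
        have := Real.log_natCast_nonneg (Fintype.card V)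
        positivity
      gcongr
      exact Finset.card_le_univ N
    exact Finset.card_eq_zero.1 (by exact_mod_cast (Nat.lt_one_iff.1 (by exact_mod_cast h1)))
  have hr : 0 ≤ (33 / δ) ^ K * W₀ := by positivity
  choose E hE hEc hEw hEp using fun i => exists_level_edges hG hw (A i) (A (i + 1)) hr (hAB i)
  refine ⟨(Finset.range K).biUnion E, ?_, ?_, ?_, ?_⟩
  · intro e he
    obtain ⟨i, -, he⟩ := Finset.mem_biUnion.1 he
    exact hE i e he
  · simpa using Finset.card_biUnion_le_card_mul (Finset.range K) E _ fun i _ => hEc i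
  · refine (sum_biUnion_le hw _ _ fun i _ => hE i).trans ?_
    refine (Finset.sum_le_card_nsmul _ _ (N.card * (B * ((33 / δ) ^ K * W₀))) fun i _ => ?_).trans
      (by simp)
    refine (hEw i).trans ?_
    gcongr
    exact hAN i
  · intro H hHG hEH W hW hWW₀ hcov x y p hp
    have hedges : ∀ i < K, ∀ e ∈ E i, e ∈ H.edgeSet := fun i hi e he =>
      hEH e (Finset.mem_biUnion.2 ⟨i, Finset.mem_range.2 hi, he⟩)
    refine conn_of_levels (r := (33 / δ) ^ K * W₀) hHG hw A K hAK hδ hδ1 hKδ hW (by gcongr) ?_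
      (by rwa [hA0]) p hp
    intro i hi u hu v hv huv
    by_cases hvb : v ∈ bunch (distKey G w) (A i) (A (i + 1)) u
    · obtain ⟨p, hp, hpe⟩ := hEp i u hu v hvb huv
      exact Or.inl (conn_of_edges (fun e he => hedges i hi e (hpe e he)) hp.le)
    · have h1 : ∃ a ∈ A (i + 1), distKey G w u a < distKey G w u v := by
        by_contra! hcon
        exact hvb (mem_bunch.2 ⟨hv, hcon⟩)
      obtain ⟨a, ha, hav⟩ := h1
      obtain ⟨m, hm, hmin⟩ := Finset.exists_min_image (A (i + 1)) (distKey G w u) ⟨a, ha⟩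
      have hmv : rdist G w u m ≤ rdist G w u v :=
        rdist_le_of_distKey_le ((hmin a ha).trans hav.le)
      obtain ⟨p, hp, hpe⟩ := hEp i u hu m (mem_bunch.2 ⟨hAA i hm, hmin⟩) (hmv.trans huv)
      exact Or.inr ⟨m, hm, conn_of_edges (fun e he => hedges i hi e (hpe e he))
        (hp.trans_le hmv)⟩

/-- The light spanner relative to a spanning tree. -/
lemma exists_light_spanner [Fintype V] (hG : G.Connected) (hw : ∀ e ∈ G.edgeSet, 0 < w e)
    (hn : 2 ≤ Fintype.card V) {T : SimpleGraph V} (hTG : T ≤ G) (hT : T.IsTree) (K : ℕ) {B : ℕ}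
    (hB : 0 < B)
    (hK : (Fintype.card V : ℝ) * ((1 + 2 * Real.log (Fintype.card V)) / B) ^ K < 1)
    {δ : ℝ} (hδ : 0 < δ) (hδ1 : δ ≤ 1) (hKδ : K * δ ≤ 1) :
    ∃ H ≤ G, T ≤ H ∧
      H.edgeSet.ncard ≤ Fintype.card V +
        (Nat.clog 2 (Fintype.card V) + 1) * (K * (Fintype.card V * B)) ∧
      gweight w H ≤ gweight w T + (Nat.clog 2 (Fintype.card V) + 1) *
        (K * (B * ((33 / δ) ^ K * (6 * gweight w T)))) ∧
      ∀ W, 0 < W → W ≤ gweight w T → ∀ (x y : V) (p : G.Walk x y), (∀ e ∈ p.edges, w e ≤ W) →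
        Conn H w x y ((1 + K * δ) * rcost w p + (33 / δ) ^ K * W) := by
  classical
  have hwT : ∀ e ∈ T.edgeSet, 0 < w e := fun e he => hw e (edgeSet_mono hTG he)
  set n := Fintype.card V with hndef
  set M := gweight w T with hMdef
  have hMsum : M = ∑ e ∈ T.edgeSet.toFinset, w e := gweight_eq_sum (by simp)
  have hTcard : T.edgeSet.toFinset.card + 1 = n := by
    have := hT.card_edgeFinset
    simpa [edgeFinset] using this
  have hM : 0 < M := by
    rw [hMsum]
    refine Finset.sum_pos (fun e he => hwT e (by simpa using he)) (Finset.card_pos.1 (by omega))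
  have hn0 : (0 : ℝ) < n := by exact_mod_cast (by omega : 0 < n)
  set J := Nat.clog 2 n with hJ
  have hJ1 : (n : ℝ) ≤ 2 ^ J := by exact_mod_cast Nat.le_pow_clog one_lt_two n
  have hJ2 : ∀ j ≤ J, (2 : ℝ) ^ j ≤ 2 * n := by
    intro j hj
    have h1 : 2 ^ (J - 1) < n := Nat.pow_pred_clog_lt_self one_lt_two (by omega)
    have h2 : (2 : ℝ) ^ (J - 1) ≤ n := by exact_mod_cast h1.le
    have h3 : 0 < J := Nat.clog_pos one_lt_two hn
    calc (2 : ℝ) ^ j ≤ 2 ^ (J - 1 + 1) := by gcongr <;> [norm_num; omega]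
      _ ≤ 2 * n := by rw [pow_succ]; linarith
  set R : ℕ → ℝ := fun j => 2 ^ j * (M / n) with hR
  have hRpos : ∀ j, 0 < R j := fun j => by positivity
  have hRM : ∀ j ≤ J, R j ≤ 2 * M := by
    intro j hj
    calc R j ≤ (2 * n) * (M / n) := by
          have := hJ2 j hj
          simp only [hR]
          gcongr
      _ = 2 * M := by field_simp
  have hRsucc : ∀ j, R (j + 1) = 2 * R j := fun j => by simp only [hR, pow_succ]; ring
  have hnet : ∀ j, ∃ N : Finset V, (j ≤ J → N.card * R j ≤ 6 * M) ∧
      ∀ W, 0 < W → (j ≠ 0 → R j ≤ 2 * W) → ∀ x, ∃ b ∈ N, Conn T w x b W := by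
    intro j
    rcases Nat.eq_zero_or_pos j with rfl | hj
    · refine ⟨Finset.univ, fun _ => ?_, fun W hW _ x => ⟨x, Finset.mem_univ x,
        Conn.refl hW.le⟩⟩
      rw [Finset.card_univ, ← hndef]
      simp only [hR, pow_zero, one_mul]
      rw [mul_div_cancel₀ _ hn0.ne']
      linarith
    · obtain ⟨N, hN, hcov⟩ := exists_net hT.1 hwT (half_pos (hRpos j))
      refine ⟨N, fun hjJ => ?_, fun W _ hW x => ?_⟩
      · have := hRM j hjJ
        linarith
      · obtain ⟨b, hb, hxb⟩ := hcov x
        exact ⟨b, hb, hxb.mono (by linarith [hW hj.ne'])⟩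
  choose N hNcard hNcov using hnet
  choose E hE hEc hEw hEconn using fun j =>
    exists_scale_edges hG hw (N j) K hB hK hδ hδ1 hKδ (hRpos j)
  set S : Finset (Sym2 V) := T.edgeSet.toFinset ∪ (Finset.range (J + 1)).biUnion E with hS
  have hSG : ∀ e ∈ S, e ∈ G.edgeSet := by
    intro e he
    rw [hS, Finset.mem_union, Finset.mem_biUnion] at he
    rcases he with he | ⟨j, -, he⟩
    · exact edgeSet_mono hTG (by simpa using he)
    · exact hE j e he
  set H : SimpleGraph V := fromEdgeSet (S : Set (Sym2 V)) with hH
  have hHS : H.edgeSet = (S : Set (Sym2 V)) := by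
    rw [hH, edgeSet_fromEdgeSet]
    refine Set.Subset.antisymm Set.sdiff_subset fun e he => ⟨he, ?_⟩
    exact G.not_isDiag_of_mem_edgeSet (hSG e he)
  have hHG : H ≤ G := edgeSet_subset_edgeSet.1 fun e he => hSG e (by rw [hHS] at he; exact he)
  have hTH : T ≤ H := edgeSet_subset_edgeSet.1 fun e he => by
    rw [hHS]
    exact Finset.mem_coe.2 (Finset.mem_union_left _ (by simpa using he))
  refine ⟨H, hHG, hTH, ?_, ?_, ?_⟩
  · rw [hHS, Set.ncard_coe_finset]
    refine (Finset.card_union_le _ _).trans (Nat.add_le_add (by omega) ?_)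
    simpa using Finset.card_biUnion_le_card_mul (Finset.range (J + 1)) E _ fun j _ => hEc j
  · rw [gweight_eq_sum hHS, hMsum]
    have h1 := Finset.sum_union_inter (s₁ := T.edgeSet.toFinset)
      (s₂ := (Finset.range (J + 1)).biUnion E) (f := w)
    have h2 : 0 ≤ ∑ e ∈ T.edgeSet.toFinset ∩ (Finset.range (J + 1)).biUnion E, w e :=
      Finset.sum_nonneg fun e he => (hwT e (by simpa using (Finset.mem_inter.1 he).1)).le
    have h3 := sum_biUnion_le hw (Finset.range (J + 1)) E fun j _ => hE j
    have h4 : ∑ j ∈ Finset.range (J + 1), ∑ e ∈ E j, w e ≤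
        (J + 1 : ℝ) * (K * (B * ((33 / δ) ^ K * (6 * M)))) := by
      refine (Finset.sum_le_card_nsmul _ _ (K * (B * ((33 / δ) ^ K * (6 * M))))
        fun j hj => ?_).trans (by simp)
      refine (hEw j).trans ?_
      have h5 := hNcard j (by have := Finset.mem_range.1 hj; omega)
      calc (K : ℝ) * ((N j).card * (B * ((33 / δ) ^ K * R j)))
          = K * (B * ((33 / δ) ^ K * ((N j).card * R j))) := by ring
        _ ≤ _ := by gcongr
    rw [← hMsum] at h1 ⊢
    linarith
  · intro W hW hWM x y p hp
    have hWJ : W ≤ R J := hWM.trans (by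
      simp only [hR]
      rw [mul_div_assoc', le_div_iff₀ hn0, mul_comm]
      exact mul_le_mul_of_nonneg_right hJ1 hM.le)
    have hex : ∃ j, W ≤ R j := ⟨J, hWJ⟩
    have hjJ : Nat.find hex ≤ J := Nat.find_min' hex hWJ
    refine hEconn (Nat.find hex) H hHG (fun e he => ?_) W hW (Nat.find_spec hex) (fun x => ?_)
      x y p hp
    · rw [hHS]
      exact Finset.mem_coe.2 (Finset.mem_union_right _ (Finset.mem_biUnion.2
        ⟨_, Finset.mem_range.2 (by omega), he⟩))
    · have h0 : Nat.find hex ≠ 0 → R (Nat.find hex) ≤ 2 * W := by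
        intro h0
        obtain ⟨j, hj⟩ := Nat.exists_eq_succ_of_ne_zero h0
        have h1 := Nat.find_min hex (m := j) (by omega)
        rw [hj, Nat.succ_eq_add_one, hRsucc]
        linarith
      obtain ⟨b, hb, hxb⟩ := hNcov (Nat.find hex) W hW h0 x
      exact ⟨b, hb, hxb.of_le hTH⟩

lemma exists_isSpanningTree_eq_mstWeight [Finite V] (hG : G.Connected) :
    ∃ T, IsSpanningTree G T ∧ gweight w T = mstWeight w G := by
  have hne : {x : ℝ | ∃ T, IsSpanningTree G T ∧ x = gweight w T}.Nonempty := by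
    obtain ⟨T, hTG, hT⟩ := hG.exists_isTree_le
    exact ⟨_, T, ⟨hTG, hT⟩, rfl⟩
  have hfin : {x : ℝ | ∃ T, IsSpanningTree G T ∧ x = gweight w T}.Finite := by
    refine (Set.finite_range fun T : SimpleGraph V => gweight w T).subset ?_
    rintro _ ⟨T, -, rfl⟩
    exact ⟨T, rfl⟩
  obtain ⟨T, hT, h⟩ := hne.csInf_mem hfin
  exact ⟨T, hT, h.symm⟩

lemma le_maxEdgeCost {x y : V} (p : G.Walk x y) {e : Sym2 V} (he : e ∈ p.edges) :
    ENNReal.ofReal (w e) ≤ maxEdgeCost w p := by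
  rw [maxEdgeCost]
  generalize p.edges = l at he
  induction l with
  | nil => simp at he
  | cons a l ih =>
    rw [List.map_cons, List.foldr_cons]
    rcases List.mem_cons.1 he with rfl | he
    · exact le_max_left _ _
    · exact (ih he).trans (le_max_right _ _)

lemma maxEdgeCost_ne_top {x y : V} (p : G.Walk x y) : maxEdgeCost w p ≠ ⊤ := by
  rw [maxEdgeCost]
  generalize p.edges = l
  induction l with
  | nil => simp
  | cons a l ih =>
    rw [List.map_cons, List.foldr_cons]
    exact (max_lt ENNReal.ofReal_lt_top ih.lt_top).ne

lemma wdist_le_of_conn {H : SimpleGraph V} (hw : ∀ e ∈ H.edgeSet, 0 < w e) {x y : V} {c : ℝ}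
    (h : Conn H w x y c) : wdist H w x y ≤ ENNReal.ofReal c := by
  obtain ⟨p, hp⟩ := h
  exact (iInf_le _ p).trans ((walkCost_eq hw p).trans_le (ENNReal.ofReal_le_ofReal hp))

lemma conn_two_mul_gweight [Fintype V] (hG : G.Connected) (hw : ∀ e ∈ G.edgeSet, 0 < w e)
    (x y : V) : Conn G w x y (2 * gweight w G) := by
  classical
  obtain ⟨p, hp, hpw⟩ := exists_tour hG hw x
  refine ⟨p.takeUntil y (hp y), le_trans ?_ hpw⟩
  conv_rhs => rw [← p.take_spec (hp y)]
  rw [rcost_append]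
  linarith [rcost_nonneg hw (p.dropUntil y (hp y))]

lemma wdist_le_of_stretch [Fintype V] {H T : SimpleGraph V} (hw : ∀ e ∈ G.edgeSet, 0 < w e)
    (hHG : H ≤ G) (hTH : T ≤ H) (hT : T.Connected) {α β : ℝ} (hα : 0 ≤ α) (hβ : 2 ≤ β)
    (h : ∀ W, 0 < W → W ≤ gweight w T → ∀ (x y : V) (p : G.Walk x y),
      (∀ e ∈ p.edges, w e ≤ W) → Conn H w x y (α * rcost w p + β * W)) (x y : V) :
    wdist H w x y ≤
      ENNReal.ofReal α * wdist G w x y + ENNReal.ofReal β * Wlocal G w x y := by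
  have hwH : ∀ e ∈ H.edgeSet, 0 < w e := fun e he => hw e (edgeSet_mono hHG he)
  rw [Wlocal, ENNReal.mul_iInf_of_ne (by simp; linarith) ENNReal.ofReal_ne_top, ENNReal.add_iInf]
  refine le_iInf ?_
  rintro ⟨p, hp⟩
  dsimp only
  rw [← hp, walkCost_eq hw]
  have hp0 := rcost_nonneg hw p
  set W := (maxEdgeCost w p).toReal with hWdef
  have hWp : maxEdgeCost w p = ENNReal.ofReal W :=
    (ENNReal.ofReal_toReal (maxEdgeCost_ne_top p)).symm
  have hW0 : 0 ≤ W := ENNReal.toReal_nonneg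
  have hle : ∀ e ∈ p.edges, w e ≤ W := fun e he => by
    have h1 := le_maxEdgeCost (w := w) p he
    rwa [hWp, ENNReal.ofReal_le_ofReal_iff hW0] at h1
  simp only [hWp]
  rw [← ENNReal.ofReal_mul hα, ← ENNReal.ofReal_mul (by linarith),
    ← ENNReal.ofReal_add (by positivity) (by positivity)]
  refine wdist_le_of_conn hwH ?_
  rcases hW0.eq_or_lt with hW | hW
  · cases p with
    | nil => exact Conn.refl (by positivity)
    | cons hadj q =>
      have h1 := hle _ (by simp; exact Or.inl rfl)
      have h2 := hw _ ((mem_edgeSet G).2 hadj)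
      linarith
  rcases le_or_gt W (gweight w T) with hWT | hWT
  · exact h W hW hWT x y p hle
  · have h1 := conn_two_mul_gweight hT (fun e he => hwH e (edgeSet_mono hTH he)) x y
    refine (h1.of_le hTH).mono ?_
    nlinarith [mul_nonneg hα hp0]

/-- The bunch size and the number of scales, compared with powers and logarithms. -/
lemma exists_bunch_size {n k : ℕ} (hn : 2 ≤ n) (hk : 1 ≤ k) :
    ∃ B : ℕ, 0 < B ∧ (n : ℝ) * ((1 + 2 * Real.log n) / B) ^ (k + 1) < 1 ∧
      (B : ℝ) ≤ 8 * ((n : ℝ) ^ ((1 : ℝ) / k) * Real.log n) := by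
  have hn' : (2 : ℝ) ≤ n := by exact_mod_cast hn
  have hk' : (0 : ℝ) < k := by exact_mod_cast hk
  have hlog : 1 / 2 ≤ Real.log n := by
    have h1 := Real.log_le_log two_pos hn'
    linarith [Real.log_two_gt_d9]
  set a : ℝ := (n : ℝ) ^ ((1 : ℝ) / k) with ha
  have ha1 : 1 < a := Real.one_lt_rpow (by linarith) (by positivity)
  have hak : a ^ k = n := by
    rw [ha, one_div]
    exact Real.rpow_inv_natCast_pow (by positivity) (by omega)
  set L := 1 + 2 * Real.log n with hL
  have hL0 : 1 ≤ L := by linarith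
  have haL : 1 ≤ a * L := by nlinarith
  have hB : a * L ≤ ⌈a * L⌉₊ := Nat.le_ceil _
  have hBpos : (0 : ℝ) < ⌈a * L⌉₊ := by linarith
  refine ⟨⌈a * L⌉₊, by exact_mod_cast hBpos, ?_, ?_⟩
  · have h1 : L / ⌈a * L⌉₊ ≤ 1 / a := by
      rw [div_le_div_iff₀ hBpos (by linarith)]
      linarith
    calc (n : ℝ) * (L / ⌈a * L⌉₊) ^ (k + 1) ≤ a ^ k * (1 / a) ^ (k + 1) := by
          rw [hak]
          gcongr
      _ = 1 / a := by
          have : a ≠ 0 := by linarith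
          field_simp
          rw [← pow_succ, ← mul_pow, mul_one_div_cancel this, one_pow]
      _ < 1 := by rw [div_lt_one (by linarith)]; exact ha1
  · have h1 := (Nat.ceil_lt_add_one (by linarith : 0 ≤ a * L)).le
    have h2 : L ≤ 4 * Real.log n := by linarith
    nlinarith

lemma clog_add_one_le {n : ℕ} (hn : 2 ≤ n) : (Nat.clog 2 n + 1 : ℝ) ≤ 6 * Real.log n := by
  have hn' : (2 : ℝ) ≤ n := by exact_mod_cast hn
  have hlog : 1 / 2 ≤ Real.log n := by
    have h1 := Real.log_le_log two_pos hn'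
    linarith [Real.log_two_gt_d9]
  have h0 : 0 < Nat.clog 2 n := Nat.clog_pos one_lt_two hn
  have h1 : 2 ^ (Nat.clog 2 n - 1) < n := Nat.pow_pred_clog_lt_self one_lt_two (by omega)
  have h2 : (2 : ℝ) ^ (Nat.clog 2 n - 1) ≤ n := by exact_mod_cast h1.le
  have h3 := Real.log_le_log (by positivity) h2
  rw [Real.log_pow, Nat.cast_sub h0] at h3
  have h4 : (1 : ℝ) ≤ Nat.clog 2 n := by exact_mod_cast h0
  push_cast at h3
  nlinarith [Real.log_two_gt_d9]

end NearAdditive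

/-- For every `0 < ε < 1` and positive integer `k` there is a constant `C ≥ 1` such that every
connected weighted graph on `n ≥ 2` vertices has a subgraph `H` that is a
`(1+ε, (Ck/ε)^k · W(·,·))`-spanner of size at most `C·k·n^{1+3/k}` and weight at most
`C·(k·n^{1/k}·(log n)²/ε)·w(MST(G))`. -/
theorem near_additive_light_spanner (ε : ℝ) (hε0 : 0 < ε) (hε1 : ε < 1) (k : ℕ) (hk : 1 ≤ k) :
    ∃ C : ℝ, 1 ≤ C ∧
      ∀ (V : Type) [Fintype V], ∀ (G : SimpleGraph V) (w : Sym2 V → ℝ),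
        G.Connected → (∀ e ∈ G.edgeSet, 0 < w e) → 2 ≤ Fintype.card V →
        ∃ H : SimpleGraph V, H ≤ G ∧
          (∀ x y : V, wdist H w x y ≤
              ENNReal.ofReal (1 + ε) * wdist G w x y +
                ENNReal.ofReal ((C * k / ε) ^ k) * Wlocal G w x y) ∧
          (H.edgeSet.ncard : ℝ) ≤ C * k * (Fintype.card V : ℝ) ^ ((1 : ℝ) + 3 / (k : ℝ)) ∧
          gweight w H ≤
            C * ((k : ℝ) * (Fintype.card V : ℝ) ^ ((1 : ℝ) / (k : ℝ)) *
              (Real.log (Fintype.card V)) ^ 2 / ε) * mstWeight w G := by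
  classical
  have hk' : (1 : ℝ) ≤ k := by exact_mod_cast hk
  set K : ℕ := k + 1 with hK
  have hK0 : (0 : ℝ) < K := by positivity
  have hK1 : (1 : ℝ) ≤ K := by exact_mod_cast (by omega : 1 ≤ k + 1)
  set δ : ℝ := ε / K with hδdef
  have hδ : 0 < δ := by positivity
  have hKδ : K * δ = ε := mul_div_cancel₀ _ hK0.ne'
  have hδ1 : δ ≤ 1 := by nlinarith
  set D : ℝ := (33 / δ) ^ K with hD
  have hD2 : 2 ≤ D := by
    have h1 : 2 ≤ 33 / δ := by rw [le_div_iff₀ hδ]; linarith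
    exact h1.trans (le_self_pow₀ (by linarith) (by omega))
  have hC1 : 0 ≤ 48 * (K : ℝ) * k ^ 2 := by positivity
  have hC2 : 0 ≤ 288 * (K : ℝ) * D := by positivity
  set C : ℝ := (1 + 48 * K * k ^ 2) + (4 * D + 288 * K * D) with hC
  have hkε : 1 ≤ k / ε := by rw [le_div_iff₀ hε0]; linarith
  refine ⟨C, by linarith, ?_⟩
  intro V _ G w hG hw hn
  obtain ⟨T, ⟨hTG, hT⟩, hTw⟩ := NearAdditive.exists_isSpanningTree_eq_mstWeight (w := w) hG
  obtain ⟨B, hB, hBK, hBle⟩ := NearAdditive.exists_bunch_size hn hk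
  obtain ⟨H, hHG, hTH, hcard, hweight, hstretch⟩ :=
    NearAdditive.exists_light_spanner hG hw hn hTG hT K hB hBK hδ hδ1 (by linarith)
  have hJ := NearAdditive.clog_add_one_le hn
  have hM : 0 ≤ gweight w T := by
    rw [NearAdditive.gweight_eq_sum (S := T.edgeSet.toFinset) (by simp)]
    exact Finset.sum_nonneg fun e he =>
      (hw e (SimpleGraph.edgeSet_mono hTG (by simpa using he))).le
  rw [← hTw]
  set n := Fintype.card V
  have hn' : (2 : ℝ) ≤ n := by exact_mod_cast hn
  set a : ℝ := (n : ℝ) ^ ((1 : ℝ) / k) with ha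
  set l : ℝ := Real.log n with hl
  have ha1 : 1 ≤ a := Real.one_le_rpow (by linarith) (by positivity)
  have hl2 : 1 / 2 ≤ l := by
    have h1 := Real.log_le_log two_pos hn'
    linarith [Real.log_two_gt_d9]
  have hla : l ≤ k * a := by
    have h1 := Real.log_le_rpow_div (x := n) (ε := 1 / k) (by linarith) (by positivity)
    rw [div_div_eq_mul_div, div_one, mul_comm] at h1
    exact h1
  have hJB : (Nat.clog 2 n + 1 : ℝ) * B ≤ 48 * (a * l ^ 2) := by
    calc (Nat.clog 2 n + 1 : ℝ) * B ≤ (6 * l) * (8 * (a * l)) := by gcongr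
      _ = _ := by ring
  refine ⟨H, hHG, ?_, ?_, ?_⟩
  · refine fun x y => (NearAdditive.wdist_le_of_stretch hw hHG hTH hT.1
      (α := 1 + K * δ) (β := D) (by rw [hKδ]; linarith) hD2 hstretch x y).trans ?_
    rw [hKδ]
    gcongr
    have h1 : C ≤ C * k / ε := by
      rw [mul_div_assoc]
      exact le_mul_of_one_le_right (by linarith) hkε
    calc D ≤ C * k / ε := by linarith
      _ ≤ _ := le_self_pow₀ (by linarith) (by omega)
  · have ha3 : (n : ℝ) ^ ((1 : ℝ) + 3 / (k : ℝ)) = n * a ^ 3 := by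
      rw [Real.rpow_add (by linarith), Real.rpow_one, ha, ← Real.rpow_natCast,
        ← Real.rpow_mul (by linarith)]
      congr 2
      push_cast
      ring
    have ha31 : 1 ≤ a ^ 3 := one_le_pow₀ ha1
    have h1 : (H.edgeSet.ncard : ℝ) ≤ n + (Nat.clog 2 n + 1) * (K * (n * B)) := by
      exact_mod_cast hcard
    have h2 : a * l ^ 2 ≤ k ^ 2 * a ^ 3 := by
      calc a * l ^ 2 ≤ a * (k * a) ^ 2 := by gcongr
        _ = _ := by ring
    calc (H.edgeSet.ncard : ℝ) ≤ n + (Nat.clog 2 n + 1) * (K * (n * B)) := h1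
      _ = n + K * n * ((Nat.clog 2 n + 1) * B) := by ring
      _ ≤ n * a ^ 3 + K * n * (48 * (k ^ 2 * a ^ 3)) := by
          refine add_le_add (le_mul_of_one_le_right (by linarith) ha31)
            (mul_le_mul_of_nonneg_left (hJB.trans ?_) (by positivity))
          gcongr
      _ = (1 + 48 * K * k ^ 2) * 1 * (n * a ^ 3) := by ring
      _ ≤ C * k * (n * a ^ 3) := by
          gcongr
          linarith
      _ = _ := by rw [ha3]
  · have h2 : 1 ≤ 4 * D * (a * l ^ 2) := by
      have h3 : 1 / 4 ≤ l ^ 2 := by nlinarith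
      have h4 : 1 / 4 ≤ a * l ^ 2 := by nlinarith
      nlinarith
    calc gweight w H ≤ gweight w T + (Nat.clog 2 n + 1) *
          (K * (B * (D * (6 * gweight w T)))) := hweight
      _ = (1 + 6 * K * D * ((Nat.clog 2 n + 1) * B)) * gweight w T := by ring
      _ ≤ (4 * D * (a * l ^ 2) + 6 * K * D * (48 * (a * l ^ 2))) * gweight w T := by
          gcongr
      _ = (4 * D + 288 * K * D) * (1 * (a * l ^ 2)) * gweight w T := by ring
      _ ≤ C * (k / ε * (a * l ^ 2)) * gweight w T := by
          gcongr
          linarith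
      _ = _ := by ring
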